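/- arXiv:2411.02554 — 5 statements merged into one kernel-verified Lean document; each statement's English description precedes it below -/
import Mathlib

section
/- Let α be a type, K ≥ 1 a natural number, f : (Fin K → α) → Bool, and D a probability distribution on α. Then for every real p > 0: Pr_{x ~ D^K}[ p_f(x) ≥ p ] ≤ (2/p) · Pr_{w ~ D^{2K}, z ~ Uniform(Fin K → Bool)}[ s^z(g_w) ≥ pK/2 ], where w ~ D^{2K} means the two tables w(0), w(1) : Fin K → α are sampled independently with i.i.d. D coordinates, and z is uniform and independent of w. -/
open scoped ENNReal
open Classical

/-- The block-resampling disagreement probability `p_f(x)`: a uniformly random coordinate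
`i : Fin K` is resampled from `D`, and we measure the probability that the value of `f`
changes. -/
noncomputable def resampleP {α : Type*} {K : ℕ} (D : PMF α) (f : (Fin K → α) → Bool)
    (x : Fin K → α) : ℝ≥0∞ :=
  (K : ℝ≥0∞)⁻¹ *
    ∑ i : Fin K, ∑' r : α, D r * (if f (Function.update x i r) ≠ f x then 1 else 0)

/-- Given a pair of tables `w`, the function `g_w(z) = f(i ↦ w (z i) i)`. -/
def gTab {α : Type*} {K : ℕ} (f : (Fin K → α) → Bool) (w : Bool → Fin K → α) :
    (Fin K → Bool) → Bool :=
  fun z => f fun i => w (z i) i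

/-- The sensitivity `s^z(g)`: the number of indices `i` with `g z ≠ g (z^{⊕ i})`. -/
def sens {K : ℕ} (g : (Fin K → Bool) → Bool) (z : Fin K → Bool) : ℕ :=
  (Finset.univ.filter fun i : Fin K => g z ≠ g (Function.update z i (!z i))).card

theorem ENNReal.tsum_pi_prod {α : Type*} {K : ℕ} (h : Fin K → α → ℝ≥0∞) :
    ∑' y : Fin K → α, ∏ i, h i (y i) = ∏ i, ∑' a, h i a := by
  induction K with
  | zero => simp
  | succ n ih =>
    rw [Fin.prod_univ_succ, ← ih, ← (Fin.consEquiv fun _ => α).tsum_eq, ENNReal.tsum_prod']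
    simp [Fin.consEquiv, Fin.prod_univ_succ, ENNReal.tsum_mul_left, ENNReal.tsum_mul_right]

theorem PMF.tsum_pi_prod {α : Type*} {K : ℕ} (D : PMF α) :
    ∑' y : Fin K → α, ∏ i, D (y i) = 1 := by
  simp [ENNReal.tsum_pi_prod fun _ : Fin K => D]

theorem PMF.tsum_pi_prod_mul_apply {α : Type*} {K : ℕ} (D : PMF α) (j : Fin K)
    (g : α → ℝ≥0∞) :
    ∑' y : Fin K → α, (∏ i, D (y i)) * g (y j) = ∑' a, D a * g a := by
  have key := ENNReal.tsum_pi_prod fun (i : Fin K) a => D a * if i = j then g a else 1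
  simp only [Finset.prod_mul_distrib, Finset.prod_ite_eq', Finset.mem_univ, if_true] at key
  rw [key, Finset.prod_eq_single j]
  · simp
  · intro i _ hij
    simp [hij]
  · simp

/-- The number of coordinates `i` at which replacing `x i` by `y i` changes the value of `f`. -/
def swapCount {α : Type*} {K : ℕ} (f : (Fin K → α) → Bool) (x y : Fin K → α) : ℕ :=
  (Finset.univ.filter fun i : Fin K => f (Function.update x i (y i)) ≠ f x).card

theorem swapCount_le {α : Type*} {K : ℕ} (f : (Fin K → α) → Bool) (x y : Fin K → α) :
    swapCount f x y ≤ K :=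
  (Finset.card_filter_le _ _).trans (by simp)

theorem resampleP_eq_tsum_swapCount {α : Type*} {K : ℕ} (D : PMF α) (f : (Fin K → α) → Bool)
    (x : Fin K → α) :
    resampleP D f x = (K : ℝ≥0∞)⁻¹ * ∑' y : Fin K → α, (∏ i, D (y i)) * swapCount f x y := by
  unfold resampleP
  congr 1
  simp_rw [swapCount, Finset.card_filter, Nat.cast_sum, Finset.mul_sum]
  rw [Summable.tsum_finsetSum fun _ _ => ENNReal.summable]
  refine Finset.sum_congr rfl fun i _ => ?_
  rw [← PMF.tsum_pi_prod_mul_apply D i]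
  simp

theorem one_le_of_le_resampleP {α : Type*} {K : ℕ} (hK : 1 ≤ K) (f : (Fin K → α) → Bool)
    (D : PMF α) {p : ℝ} (hp : 0 < p) {x : Fin K → α}
    (hx : ENNReal.ofReal p ≤ resampleP D f x) :
    1 ≤ ENNReal.ofReal (2 / p) * ∑' y : Fin K → α,
      (∏ i, D (y i)) * (if p * K / 2 ≤ (swapCount f x y : ℝ) then 1 else 0) := by
  set P : ℝ≥0∞ := ∑' y : Fin K → α,
    (∏ i, D (y i)) * (if p * K / 2 ≤ (swapCount f x y : ℝ) then 1 else 0) with hP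
  have hK0 : (K : ℝ≥0∞) ≠ 0 := by simp; omega
  have hKt : (K : ℝ≥0∞) ≠ ⊤ := ENNReal.natCast_ne_top K
  have hcount (y : Fin K → α) : (swapCount f x y : ℝ≥0∞) ≤
      K * (ENNReal.ofReal (p / 2) + if p * K / 2 ≤ (swapCount f x y : ℝ) then 1 else 0) := by
    split_ifs with h
    · calc (swapCount f x y : ℝ≥0∞) ≤ K * 1 := by simpa using swapCount_le f x y
        _ ≤ _ := by gcongr; exact le_add_self
    · rw [add_zero, ← ENNReal.ofReal_natCast, ← ENNReal.ofReal_natCast,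
        ← ENNReal.ofReal_mul (by positivity)]
      exact ENNReal.ofReal_le_ofReal (by linarith)
  have hmean : ENNReal.ofReal p ≤ ENNReal.ofReal (p / 2) + P := by
    calc ENNReal.ofReal p ≤ _ := hx
      _ ≤ (K : ℝ≥0∞)⁻¹ * ∑' y : Fin K → α, (∏ i, D (y i)) *
          (K * (ENNReal.ofReal (p / 2) +
            if p * K / 2 ≤ (swapCount f x y : ℝ) then 1 else 0)) := by
        rw [resampleP_eq_tsum_swapCount]
        gcongr with y
        exact hcount y
      _ = ENNReal.ofReal (p / 2) + P := by
        simp_rw [mul_left_comm _ (K : ℝ≥0∞), mul_add (∏ i, D _)]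
        rw [ENNReal.tsum_mul_left, ← mul_assoc, ENNReal.inv_mul_cancel hK0 hKt, one_mul,
          ENNReal.tsum_add, ENNReal.tsum_mul_right, D.tsum_pi_prod, one_mul]
  have hhalf : ENNReal.ofReal (p / 2) ≤ P := by
    have hsplit : ENNReal.ofReal p = ENNReal.ofReal (p / 2) + ENNReal.ofReal (p / 2) := by
      rw [← ENNReal.ofReal_add (by positivity) (by positivity), add_halves]
    rw [hsplit] at hmean
    exact (ENNReal.add_le_add_iff_left ENNReal.ofReal_ne_top).1 hmean
  calc (1 : ℝ≥0∞) = ENNReal.ofReal (2 / p) * ENNReal.ofReal (p / 2) := by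
        rw [← ENNReal.ofReal_mul (by positivity)]
        field_simp
        simp
    _ ≤ _ := by gcongr

/-- The pair of tables whose row `i` is `x i` in table `z i` and `y i` in the other table. -/
def tablesEquiv (α : Type*) {K : ℕ} (z : Fin K → Bool) :
    (Fin K → α) × (Fin K → α) ≃ (Bool → Fin K → α) where
  toFun q b i := if b = z i then q.1 i else q.2 i
  invFun w := (fun i => w (z i) i, fun i => w (!z i) i)
  left_inv q := by ext i <;> simp
  right_inv w := by
    ext b i
    by_cases h : b = z i
    · simp [h]
    · simp [Bool.eq_not.2 h]

theorem prod_tablesEquiv {α : Type*} {K : ℕ} (D : PMF α) (z : Fin K → Bool)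
    (x y : Fin K → α) :
    ∏ b, ∏ i, D (tablesEquiv α z (x, y) b i) = (∏ i, D (x i)) * ∏ i, D (y i) := by
  rw [Finset.prod_comm, ← Finset.prod_mul_distrib]
  refine Finset.prod_congr rfl fun i _ => ?_
  cases h : z i <;> simp [tablesEquiv, h, mul_comm]

theorem sens_gTab_tablesEquiv {α : Type*} {K : ℕ} (f : (Fin K → α) → Bool) (z : Fin K → Bool)
    (x y : Fin K → α) :
    sens (gTab f (tablesEquiv α z (x, y))) z = swapCount f x y := by
  unfold sens swapCount
  congr 1
  refine Finset.filter_congr fun i _ => ?_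
  have hflip : (fun j => tablesEquiv α z (x, y) (Function.update z i (!z i) j) j) =
      Function.update x i (y i) := by
    ext j
    by_cases h : j = i
    · subst h; simp [tablesEquiv]
    · simp [tablesEquiv, h]
  have hz : (fun j => tablesEquiv α z (x, y) (z j) j) = x := by
    ext j
    simp [tablesEquiv]
  rw [gTab, gTab, hflip, hz, ne_comm]

theorem tsum_sens_gTab {α : Type*} {K : ℕ} (f : (Fin K → α) → Bool) (D : PMF α) (t : ℝ) :
    ∑' w : Bool → Fin K → α, ∑ z : Fin K → Bool,
        (∏ b, ∏ i, D (w b i)) * ((2 : ℝ≥0∞) ^ K)⁻¹ *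
          (if t ≤ (sens (gTab f w) z : ℝ) then 1 else 0) =
      ∑' x : Fin K → α, (∏ i, D (x i)) * ∑' y : Fin K → α,
        (∏ i, D (y i)) * (if t ≤ (swapCount f x y : ℝ) then 1 else 0) := by
  rw [Summable.tsum_finsetSum fun _ _ => ENNReal.summable]
  have hz (z : Fin K → Bool) : ∑' w : Bool → Fin K → α,
        (∏ b, ∏ i, D (w b i)) * ((2 : ℝ≥0∞) ^ K)⁻¹ *
          (if t ≤ (sens (gTab f w) z : ℝ) then 1 else 0) =
      ((2 : ℝ≥0∞) ^ K)⁻¹ * ∑' x : Fin K → α, (∏ i, D (x i)) * ∑' y : Fin K → α,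
        (∏ i, D (y i)) * (if t ≤ (swapCount f x y : ℝ) then 1 else 0) := by
    rw [← (tablesEquiv α z).tsum_eq, ENNReal.tsum_prod', ← ENNReal.tsum_mul_left]
    refine tsum_congr fun x => ?_
    rw [← ENNReal.tsum_mul_left, ← ENNReal.tsum_mul_left]
    refine tsum_congr fun y => ?_
    rw [prod_tablesEquiv, sens_gTab_tablesEquiv]
    ring
  rw [Finset.sum_congr rfl fun z _ => hz z, Finset.sum_const, nsmul_eq_mul, ← mul_assoc]
  have hcard : ((Finset.univ : Finset (Fin K → Bool)).card : ℝ≥0∞) = 2 ^ K := by simp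
  rw [hcard, ENNReal.mul_inv_cancel (by simp) (by simp), one_mul]

theorem resample_prob_le_sens_prob {α : Type*} {K : ℕ} (hK : 1 ≤ K)
    (f : (Fin K → α) → Bool) (D : PMF α) (p : ℝ) (hp : 0 < p) :
    (∑' x : Fin K → α,
        (∏ i, D (x i)) * (if ENNReal.ofReal p ≤ resampleP D f x then 1 else 0)) ≤
      ENNReal.ofReal (2 / p) *
        ∑' w : Bool → Fin K → α, ∑ z : Fin K → Bool,
          (∏ b, ∏ i, D (w b i)) * ((2 : ℝ≥0∞) ^ K)⁻¹ *
            (if p * K / 2 ≤ (sens (gTab f w) z : ℝ) then 1 else 0) := by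
  rw [tsum_sens_gTab, ← ENNReal.tsum_mul_left]
  refine ENNReal.tsum_le_tsum fun x => ?_
  rw [mul_left_comm]
  gcongr
  split_ifs with hx
  · exact one_le_of_le_resampleP hK f D hp hx
  · exact zero_le
end

section
/- Let α be a type, K a natural number, f : (Fin K → α) → Bool, x x' : Fin K → α, and z : Fin K → Bool. Define the pair of tables w : Bool → (Fin K → α) by w(b)(i) = x(i) if b = z(i) and w(b)(i) = x'(i) otherwise. Then g_w(z) = f(x), and the sensitivity s^z(g_w) equals the number of indices i ∈ Fin K such that f(x) ≠ f(update x i (x'(i))), where update x i a replaces the i-th coordinate of x by a. -/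
open Classical

/-- Flipping the `i`-th bit of `z` replaces the `i`-th row selected from the tables
`w b i = if b = z i then x i else x' i` by `x' i`. -/
theorem gTab_update_not {α : Type*} {K : ℕ} (f : (Fin K → α) → Bool)
    (x x' : Fin K → α) (z : Fin K → Bool) (i : Fin K) :
    gTab f (fun b i => if b = z i then x i else x' i) (Function.update z i (!z i)) =
      f (Function.update x i (x' i)) := by
  unfold gTab
  congr 1
  funext j
  by_cases h : j = i
  · subst h
    simp
  · simp [h]

/-- With the tables `w b i = if b = z i then x i else x' i`, we have `g_w(z) = f(x)`, and the
sensitivity of `g_w` at `z` counts the indices `i` such that replacing the `i`-th coordinate of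
`x` by `x' i` changes the value of `f`. -/
theorem gTab_apply_and_sens {α : Type*} {K : ℕ} (f : (Fin K → α) → Bool)
    (x x' : Fin K → α) (z : Fin K → Bool) :
    gTab f (fun b i => if b = z i then x i else x' i) z = f x ∧
      sens (gTab f (fun b i => if b = z i then x i else x' i)) z =
        (Finset.univ.filter fun i : Fin K =>
          f x ≠ f (Function.update x i (x' i))).card := by
  have h : gTab f (fun b i => if b = z i then x i else x' i) z = f x := by
    simp [gTab]
  refine ⟨h, ?_⟩
  simp only [sens, h, gTab_update_not]
end

section
/- Let α be a type, K a natural number, and D a probability distribution on α. Sample x, x' : Fin K → α independently from D^K and z : Fin K → Bool uniformly, independently of (x, x'). Define w : Bool → (Fin K → α) by w(b)(i) = x(i) if b = z(i) and w(b)(i) = x'(i) otherwise. Then the joint distribution of (z, w) is the product of the uniform distribution on Fin K → Bool and the distribution of two independent D^K-samples; in particular, w is independent of z and the pair (w(false), w(true)) has i.i.d. D coordinates. -/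
open scoped ENNReal
open Classical

theorem table_eq_iff {α ι : Type*} (z : ι → Bool) (x x' : ι → α) (w : Bool → ι → α) :
    (fun b i => if b = z i then x i else x' i) = w ↔
      x = (fun i => w (z i) i) ∧ x' = fun i => w (!z i) i := by
  constructor
  · rintro rfl
    simp
  · rintro ⟨rfl, rfl⟩
    funext b i
    cases b <;> cases h : z i <;> simp [h]

/-- Sample `x, x' ~ D^K` independently and `z` uniform on `Fin K → Bool`, independent of
`(x, x')`; form the tables `w b i = if b = z i then x i else x' i`.  Then the joint distribution
of `(z, w)` is the product of the uniform distribution on `Fin K → Bool` with the distribution of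
two independent `D^K` samples: the probability of seeing any fixed pair `(z₀, w₀)` equals
`2^{-K} · ∏ b ∏ i D (w₀ b i)`. -/
theorem joint_dist_of_tables {α : Type*} {K : ℕ} (D : PMF α) (z₀ : Fin K → Bool)
    (w₀ : Bool → Fin K → α) :
    (∑' x : Fin K → α, ∑' x' : Fin K → α, ∑ z : Fin K → Bool,
        (∏ i, D (x i)) * (∏ i, D (x' i)) * ((2 : ℝ≥0∞) ^ K)⁻¹ *
          (if z = z₀ ∧ (fun b i => if b = z i then x i else x' i) = w₀ then 1 else 0)) =
      ((2 : ℝ≥0∞) ^ K)⁻¹ * ∏ b, ∏ i, D (w₀ b i) := by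
  have sum_z (x x' : Fin K → α) :
      (∑ z : Fin K → Bool, (∏ i, D (x i)) * (∏ i, D (x' i)) * ((2 : ℝ≥0∞) ^ K)⁻¹ *
        (if z = z₀ ∧ (fun b i => if b = z i then x i else x' i) = w₀ then 1 else 0)) =
      if x = (fun i => w₀ (z₀ i) i) ∧ x' = (fun i => w₀ (!z₀ i) i) then
        (∏ i, D (x i)) * (∏ i, D (x' i)) * ((2 : ℝ≥0∞) ^ K)⁻¹ else 0 := by
    rw [Finset.sum_eq_single z₀ (fun z _ hz => by simp [hz]) (by simp)]
    simp only [table_eq_iff, true_and, mul_ite, mul_one, mul_zero]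
  simp only [sum_z]
  rw [tsum_eq_single (fun i => w₀ (z₀ i) i) (fun x hx => by simp [hx]),
    tsum_eq_single (fun i => w₀ (!z₀ i) i) (fun x' hx' => by simp [hx'])]
  rw [if_pos ⟨rfl, rfl⟩, mul_comm, ← Finset.prod_mul_distrib, Finset.prod_comm]
  congr 1
  refine Finset.prod_congr rfl fun i _ => ?_
  cases h : z₀ i <;> simp [h, mul_comm]
end

section
/- Let α be a type, N a natural number, μ and ν probability distributions on α, C : (Fin N → α) → Bool, and δ' ≥ 0 a real. Suppose that for every index i ∈ Fin N and every v : Fin N → α, |Pr_{a ~ μ}[C(update v i a) = 1] − Pr_{a ~ ν}[C(update v i a) = 1]| ≤ δ', where update v i a replaces the i-th coordinate of v by a. Then for every z : Fin N → Bool, |Pr_{x ~ P_z}[C(x) = 1] − Pr_{x ~ ν^N}[C(x) = 1]| ≤ N · δ'. -/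
open scoped ENNReal
open Classical

/-- `Pr_{a ~ μ}[C (update v i a) = 1]`. -/
noncomputable def updPr {α : Type*} {N : ℕ} (μ : PMF α) (C : (Fin N → α) → Bool)
    (i : Fin N) (v : Fin N → α) : ℝ :=
  (∑' a : α, μ a * (if C (Function.update v i a) = true then 1 else 0)).toReal

/-- `Pr_{x ~ P_z}[C x = 1]`, where the patterned product distribution `P_z` samples coordinate
`i` from `μ` if `z i = true` and from `ν` if `z i = false`, independently. -/
noncomputable def patPr {α : Type*} {N : ℕ} (μ ν : PMF α) (z : Fin N → Bool)
    (C : (Fin N → α) → Bool) : ℝ :=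
  (∑' x : Fin N → α,
      (∏ i, if z i then μ (x i) else ν (x i)) * (if C x = true then 1 else 0)).toReal

/-- Summation against a product of weights, with the zeroth coordinate summed last. -/
theorem ENNReal.tsum_prod_mul_fin_succ {α : Type*} {N : ℕ} (p : Fin (N + 1) → α → ℝ≥0∞)
    (f : (Fin (N + 1) → α) → ℝ≥0∞) :
    ∑' x : Fin (N + 1) → α, (∏ i, p i (x i)) * f x =
      ∑' a, p 0 a * ∑' y : Fin N → α, (∏ i, p i.succ (y i)) * f (Fin.cons a y) := by
  rw [← (Fin.consEquiv fun _ : Fin (N + 1) => α).tsum_eq, ENNReal.tsum_prod']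
  simp only [Fin.consEquiv_apply, Fin.prod_univ_succ, Fin.cons_zero, Fin.cons_succ, mul_assoc,
    ENNReal.tsum_mul_left]
  rfl

theorem PMF.tsum_prod_fin {α : Type*} {N : ℕ} (p : Fin N → PMF α) :
    ∑' x : Fin N → α, ∏ i, p i (x i) = 1 := by
  induction N with
  | zero => simp
  | succ N ih =>
    have := ENNReal.tsum_prod_mul_fin_succ (fun i => (p i : α → ℝ≥0∞)) fun _ => 1
    simpa [ih fun i => p i.succ, PMF.tsum_coe] using this

theorem PMF.tsum_prod_mul_ne_top {α : Type*} {N : ℕ} (p : Fin N → PMF α)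
    {f : (Fin N → α) → ℝ≥0∞} (hf : ∀ x, f x ≤ 1) :
    ∑' x : Fin N → α, (∏ i, p i (x i)) * f x ≠ ∞ := by
  refine ne_top_of_le_ne_top ENNReal.one_ne_top ?_
  rw [← PMF.tsum_prod_fin p]
  exact ENNReal.tsum_le_tsum fun x => mul_le_of_le_one_right' (hf x)

/-- One-sided hybrid argument for product distributions. -/
theorem PMF.tsum_prod_mul_le_add {α : Type*} {N : ℕ} (p q : Fin N → PMF α)
    (f : (Fin N → α) → ℝ≥0∞) (δ : ℝ≥0∞)
    (h : ∀ i v, ∑' a, p i a * f (Function.update v i a) ≤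
      ∑' a, q i a * f (Function.update v i a) + δ) :
    ∑' x : Fin N → α, (∏ i, p i (x i)) * f x ≤
      ∑' x : Fin N → α, (∏ i, q i (x i)) * f x + N * δ := by
  induction N with
  | zero => simp
  | succ N ih =>
    rw [ENNReal.tsum_prod_mul_fin_succ (fun i => (p i : α → ℝ≥0∞)),
      ENNReal.tsum_prod_mul_fin_succ (fun i => (q i : α → ℝ≥0∞))]
    have swap (r : PMF α) :
        ∑' a, r a * ∑' y : Fin N → α, (∏ i, q i.succ (y i)) * f (Fin.cons a y) =
          ∑' y : Fin N → α, (∏ i, q i.succ (y i)) * ∑' a, r a * f (Fin.cons a y) := by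
      simp only [← ENNReal.tsum_mul_left]
      rw [ENNReal.tsum_comm]
      simp only [mul_left_comm]
    calc
      _ ≤ ∑' a, p 0 a *
          (∑' y : Fin N → α, (∏ i, q i.succ (y i)) * f (Fin.cons a y) + N * δ) := by
        gcongr with a
        refine ih _ _ (fun y => f (Fin.cons a y)) fun i v => ?_
        simpa only [Fin.cons_update] using h i.succ (Fin.cons a v)
      _ = ∑' y : Fin N → α, (∏ i, q i.succ (y i)) * ∑' a, p 0 a * f (Fin.cons a y) + N * δ := by
        simp only [mul_add, ENNReal.tsum_add, ENNReal.tsum_mul_right, PMF.tsum_coe, one_mul, swap]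
      _ ≤ ∑' y : Fin N → α, (∏ i, q i.succ (y i)) * (∑' a, q 0 a * f (Fin.cons a y) + δ) +
          N * δ := by
        gcongr with y
        rcases isEmpty_or_nonempty α with hα | ⟨⟨a₀⟩⟩
        · simp
        · simpa only [Fin.update_cons_zero] using h 0 (Fin.cons a₀ y)
      _ = _ := by
        simp only [mul_add, ENNReal.tsum_add, ENNReal.tsum_mul_right,
          PMF.tsum_prod_fin fun i : Fin N => q i.succ, one_mul, swap, Nat.cast_add, Nat.cast_one,
          add_mul]
        ring

theorem ENNReal.le_add_ofReal_of_abs_toReal_sub_le {a b : ℝ≥0∞} {δ : ℝ} (ha : a ≠ ∞)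
    (hb : b ≠ ∞) (h : |a.toReal - b.toReal| ≤ δ) : a ≤ b + ENNReal.ofReal δ := by
  have hδ : 0 ≤ δ := (abs_nonneg _).trans h
  rw [← ENNReal.toReal_le_toReal ha (by finiteness), ENNReal.toReal_add hb (by finiteness),
    ENNReal.toReal_ofReal hδ]
  linarith [(abs_le.mp h).2]

theorem ENNReal.toReal_sub_toReal_le {a b : ℝ≥0∞} {n : ℕ} {δ : ℝ} (hb : b ≠ ∞)
    (hδ : 0 ≤ δ) (h : a ≤ b + n * ENNReal.ofReal δ) : a.toReal - b.toReal ≤ n * δ := by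
  have := ENNReal.toReal_mono (by finiteness) h
  rw [ENNReal.toReal_add hb (by finiteness), ENNReal.toReal_mul, ENNReal.toReal_natCast,
    ENNReal.toReal_ofReal hδ] at this
  linarith

/-- Hybrid argument: if resampling any single coordinate from `μ` rather than `ν` changes the
acceptance probability of `C` by at most `δ'`, then for any pattern `z`, the acceptance
probabilities under `P_z` and under `ν^N` differ by at most `N·δ'`. -/
theorem patPr_sub_prod_le {α : Type*} {N : ℕ} (μ ν : PMF α) (C : (Fin N → α) → Bool)
    (δ' : ℝ) (hδ' : 0 ≤ δ')
    (h : ∀ (i : Fin N) (v : Fin N → α), |updPr μ C i v - updPr ν C i v| ≤ δ') :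
    ∀ z : Fin N → Bool,
      |patPr μ ν z C -
          (∑' x : Fin N → α, (∏ i, ν (x i)) * (if C x = true then 1 else 0)).toReal| ≤
        N * δ' := by
  intro z
  set f : (Fin N → α) → ℝ≥0∞ := fun x => if C x = true then 1 else 0 with hf
  have hf1 (x) : f x ≤ 1 := by
    simp only [hf]
    split_ifs <;> simp
  have hupd (r : PMF α) (i : Fin N) (v : Fin N → α) :
      ∑' a, r a * f (Function.update v i a) ≠ ∞ := by
    refine ne_top_of_le_ne_top ENNReal.one_ne_top ?_
    rw [← r.tsum_coe]
    exact ENNReal.tsum_le_tsum fun a => mul_le_of_le_one_right' (hf1 _)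
  have hle (i : Fin N) (v : Fin N → α) :=
    ENNReal.le_add_ofReal_of_abs_toReal_sub_le (hupd μ i v) (hupd ν i v) (h i v)
  have hge (i : Fin N) (v : Fin N → α) :=
    ENNReal.le_add_ofReal_of_abs_toReal_sub_le (hupd ν i v) (hupd μ i v)
      ((abs_sub_comm _ _).trans_le (h i v))
  let p : Fin N → PMF α := fun i => if z i then μ else ν
  have hp : patPr μ ν z C = (∑' x : Fin N → α, (∏ i, p i (x i)) * f x).toReal := by
    simp only [patPr, p, hf, apply_ite (DFunLike.coe : PMF α → α → ℝ≥0∞), ite_apply]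
  rw [hp, abs_sub_le_iff]
  constructor
  · refine ENNReal.toReal_sub_toReal_le (PMF.tsum_prod_mul_ne_top (fun _ => ν) hf1) hδ' ?_
    refine PMF.tsum_prod_mul_le_add p (fun _ => ν) f _ fun i v => ?_
    by_cases hz : z i
    · simpa only [p, hz, if_true] using hle i v
    · simp [p, hz]
  · refine ENNReal.toReal_sub_toReal_le (PMF.tsum_prod_mul_ne_top p hf1) hδ' ?_
    refine PMF.tsum_prod_mul_le_add (fun _ => ν) p f _ fun i v => ?_
    by_cases hz : z i
    · simpa only [p, hz, if_true] using hge i v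
    · simp [p, hz]
end

section
/- Let α be a type, K ≥ 1 a natural number, f : (Fin K → α) → Bool, μ and ν probability distributions on α, δ ≥ 0 a real, and c > 0 a real constant. Suppose: (i) for every x : Fin K → α and every i ∈ Fin K, |Pr_{w ~ μ}[f(update x i w) ≠ f(x)] − Pr_{w ~ ν}[f(update x i w) ≠ f(x)]| ≤ δ; and (ii) for every pair of tables w : Bool → (Fin K → α) and every real t > 0, Pr_{z ~ Uniform(Fin K → Bool)}[ s^z(g_w) ≥ t ] ≤ 2K · 2^{-t/c}. Then for every real p > 0: Pr_{x ~ ν^K}[ Pr_{i ~ Uniform(Fin K), w ~ μ}[f(update x i w) ≠ f(x)] ≥ p + δ ] ≤ (4K/p) · 2^{-pK/(2c)}. -/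
open scoped ENNReal
open Classical

/-- `Pr_{w ~ D}[f (update x i w) ≠ f x]`. -/
noncomputable def coordFlipPr {α : Type*} {K : ℕ} (D : PMF α) (f : (Fin K → α) → Bool)
    (x : Fin K → α) (i : Fin K) : ℝ :=
  (∑' w : α, D w * (if f (Function.update x i w) ≠ f x then 1 else 0)).toReal

/-- `Pr_{i ~ Uniform(Fin K), w ~ D}[f (update x i w) ≠ f x]`. -/
noncomputable def rowFlipPr {α : Type*} {K : ℕ} (D : PMF α) (f : (Fin K → α) → Bool)
    (x : Fin K → α) : ℝ :=
  (K : ℝ)⁻¹ * ∑ i : Fin K, coordFlipPr D f x i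

/-- The sum over all tuples of a product of nonnegative functions is the product of the sums. -/
lemma tsum_prod_pi_fin {α : Type*} : ∀ {K : ℕ} (g : Fin K → α → ℝ≥0∞),
    ∑' x : Fin K → α, ∏ i, g i (x i) = ∏ i, ∑' a, g i a
  | 0, g => by simp
  | K + 1, g => by
    rw [← (Fin.consEquiv fun _ : Fin (K + 1) => α).tsum_eq, ENNReal.tsum_prod']
    simp only [Fin.consEquiv_apply, Fin.prod_univ_succ, Fin.cons_zero, Fin.cons_succ,
      ENNReal.tsum_mul_left, ENNReal.tsum_mul_right]
    rw [tsum_prod_pi_fin fun i => g i.succ]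

lemma PMF.tsum_prod_pi {α : Type*} {K : ℕ} (ν : PMF α) :
    ∑' x : Fin K → α, ∏ i, ν (x i) = 1 := by
  simp [tsum_prod_pi_fin fun _ : Fin K => (ν : α → ℝ≥0∞), ν.tsum_coe]

/-- A single coordinate of a vector with i.i.d. `ν` coordinates has law `ν`. -/
lemma PMF.tsum_prod_pi_mul_apply {α : Type*} {K : ℕ} (ν : PMF α) (i : Fin K) (h : α → ℝ≥0∞) :
    ∑' x : Fin K → α, (∏ j, ν (x j)) * h (x i) = ∑' a, ν a * h a := by
  have key := tsum_prod_pi_fin fun (j : Fin K) a => ν a * (if j = i then h a else 1)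
  simp only [Finset.prod_mul_distrib, Finset.prod_ite_eq', Finset.mem_univ, if_true] at key
  rw [key, Finset.prod_eq_single i]
  · simp
  · intro j _ hj
    simp [hj, ν.tsum_coe]
  · simp

/-- The number of coordinates `i` at which replacing `x i` by `y i` changes `f`. -/
noncomputable def crossSens {α : Type*} {K : ℕ} (f : (Fin K → α) → Bool)
    (x y : Fin K → α) : ℕ :=
  (Finset.univ.filter fun i : Fin K => f x ≠ f (Function.update x i (y i))).card

/-- Swap the entries of a pair of vectors at the coordinates selected by `z`. -/
def swapAlong {α : Type*} {K : ℕ} (z : Fin K → Bool) :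
    (Fin K → α) × (Fin K → α) ≃ (Fin K → α) × (Fin K → α) :=
  Function.Involutive.toPerm
    (fun q => (fun i => bif z i then q.2 i else q.1 i, fun i => bif z i then q.1 i else q.2 i))
    (by
      rintro ⟨a, b⟩
      ext i <;> cases h : z i <;> simp [h])

lemma swapAlong_apply {α : Type*} {K : ℕ} (z : Fin K → Bool)
    (q : (Fin K → α) × (Fin K → α)) :
    swapAlong z q =
      (fun i => bif z i then q.2 i else q.1 i, fun i => bif z i then q.1 i else q.2 i) :=
  rfl

lemma prod_swapAlong {α : Type*} {K : ℕ} (ν : α → ℝ≥0∞) (z : Fin K → Bool)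
    (q : (Fin K → α) × (Fin K → α)) :
    (∏ i, ν ((swapAlong z q).1 i)) * ∏ i, ν ((swapAlong z q).2 i) =
      (∏ i, ν (q.1 i)) * ∏ i, ν (q.2 i) := by
  rw [← Finset.prod_mul_distrib, ← Finset.prod_mul_distrib]
  refine Finset.prod_congr rfl fun i _ => ?_
  cases h : z i <;> simp [swapAlong_apply, h, mul_comm]

lemma sens_gTab_eq_crossSens {α : Type*} {K : ℕ} (f : (Fin K → α) → Bool) (z : Fin K → Bool)
    (q : (Fin K → α) × (Fin K → α)) :
    sens (gTab f fun b => bif b then q.2 else q.1) z =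
      crossSens f (swapAlong z q).1 (swapAlong z q).2 := by
  have base : (fun i => (bif z i then q.2 else q.1) i) = (swapAlong z q).1 := by
    funext i
    cases h : z i <;> simp [swapAlong_apply, h]
  have flip (i : Fin K) :
      (fun j => (bif Function.update z i (!z i) j then q.2 else q.1) j) =
        Function.update (swapAlong z q).1 i ((swapAlong z q).2 i) := by
    funext j
    rcases eq_or_ne j i with rfl | hj
    · cases h : z j <;> simp [swapAlong_apply, h]
    · cases h : z j <;> simp [swapAlong_apply, h, hj]
  unfold sens crossSens gTab
  simp only [base, flip]

/-- If the sensitivity tail of every `g_w` is at most `B`, then so is the tail of the number of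
coordinates where two independent samples of `ν^K` differ in a way that `f` sees. -/
lemma tsum_crossSens_le {α : Type*} {K : ℕ} (f : (Fin K → α) → Bool) (ν : PMF α) (t : ℝ)
    (B : ℝ≥0∞)
    (hB : ∀ w : Bool → Fin K → α,
      (∑ z : Fin K → Bool,
          ((2 : ℝ≥0∞) ^ K)⁻¹ * (if t ≤ (sens (gTab f w) z : ℝ) then 1 else 0)) ≤ B) :
    ∑' x : Fin K → α, (∏ i, ν (x i)) *
      ∑' y : Fin K → α, (∏ i, ν (y i)) * (if t ≤ (crossSens f x y : ℝ) then 1 else 0) ≤ B := by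
  set N : (Fin K → α) × (Fin K → α) → ℝ≥0∞ := fun q => (∏ i, ν (q.1 i)) * ∏ i, ν (q.2 i)
    with hN
  have hN1 : ∑' q, N q = 1 := by
    rw [ENNReal.tsum_prod']
    simp only [hN, ENNReal.tsum_mul_left, ν.tsum_prod_pi, mul_one]
  set A : ℝ≥0∞ := ∑' q : (Fin K → α) × (Fin K → α),
    N q * (if t ≤ (crossSens f q.1 q.2 : ℝ) then 1 else 0) with hA
  have hLHS : ∑' x : Fin K → α, (∏ i, ν (x i)) *
      ∑' y : Fin K → α, (∏ i, ν (y i)) * (if t ≤ (crossSens f x y : ℝ) then 1 else 0) = A := by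
    rw [hA, ENNReal.tsum_prod']
    simp only [hN, mul_assoc, ENNReal.tsum_mul_left]
  have hz (z : Fin K → Bool) : A = ∑' q : (Fin K → α) × (Fin K → α), N q *
      (if t ≤ (sens (gTab f fun b => bif b then q.2 else q.1) z : ℝ) then 1 else 0) := by
    rw [hA, ← (swapAlong z).tsum_eq]
    refine tsum_congr fun q => ?_
    rw [sens_gTab_eq_crossSens]
    congr 1
    exact prod_swapAlong ν z q
  have h2 : ∑ _z : Fin K → Bool, ((2 : ℝ≥0∞) ^ K)⁻¹ = 1 := by
    simp only [Finset.sum_const, Finset.card_univ, Fintype.card_fun, Fintype.card_bool,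
      Fintype.card_fin, nsmul_eq_mul, Nat.cast_pow, Nat.cast_ofNat]
    exact ENNReal.mul_inv_cancel (by simp) (by simp)
  rw [hLHS]
  calc A = ∑ z : Fin K → Bool, ((2 : ℝ≥0∞) ^ K)⁻¹ * A := by
        rw [← Finset.sum_mul, h2, one_mul]
    _ = ∑ z : Fin K → Bool, ∑' q : (Fin K → α) × (Fin K → α), N q * (((2 : ℝ≥0∞) ^ K)⁻¹ *
          (if t ≤ (sens (gTab f fun b => bif b then q.2 else q.1) z : ℝ) then 1 else 0)) := by
        refine Finset.sum_congr rfl fun z _ => ?_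
        rw [hz z, ← ENNReal.tsum_mul_left]
        exact tsum_congr fun q => mul_left_comm _ _ _
    _ = ∑' q : (Fin K → α) × (Fin K → α), N q * ∑ z : Fin K → Bool, (((2 : ℝ≥0∞) ^ K)⁻¹ *
          (if t ≤ (sens (gTab f fun b => bif b then q.2 else q.1) z : ℝ) then 1 else 0)) := by
        rw [← Summable.tsum_finsetSum fun _ _ => ENNReal.summable]
        exact tsum_congr fun q => (Finset.mul_sum _ _ _).symm
    _ ≤ ∑' q, N q * B := ENNReal.tsum_le_tsum fun q => mul_le_mul_right (hB _) _
    _ = B := by rw [ENNReal.tsum_mul_right, hN1, one_mul]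

lemma ofReal_coordFlipPr {α : Type*} {K : ℕ} (D : PMF α) (f : (Fin K → α) → Bool)
    (x : Fin K → α) (i : Fin K) :
    ENNReal.ofReal (coordFlipPr D f x i) =
      ∑' w : α, D w * (if f (Function.update x i w) ≠ f x then 1 else 0) := by
  refine ENNReal.ofReal_toReal (ne_top_of_le_ne_top ENNReal.one_ne_top ?_)
  rw [← D.tsum_coe]
  refine ENNReal.tsum_le_tsum fun w => ?_
  split_ifs <;> simp

/-- `K` times the row flip probability is the expected number of changing coordinates. -/
lemma ofReal_sum_coordFlipPr {α : Type*} {K : ℕ} (ν : PMF α) (f : (Fin K → α) → Bool)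
    (x : Fin K → α) :
    ENNReal.ofReal (∑ i, coordFlipPr ν f x i) =
      ∑' y : Fin K → α, (∏ i, ν (y i)) * (crossSens f x y : ℝ≥0∞) := by
  rw [ENNReal.ofReal_sum_of_nonneg (f := coordFlipPr ν f x) fun i _ => ENNReal.toReal_nonneg]
  simp only [ofReal_coordFlipPr]
  have h (i : Fin K) := (ν.tsum_prod_pi_mul_apply i
    fun a => if f (Function.update x i a) ≠ f x then 1 else 0).symm
  simp only [h]
  rw [← Summable.tsum_finsetSum fun _ _ => ENNReal.summable]
  refine tsum_congr fun y => ?_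
  rw [← Finset.mul_sum, Finset.sum_boole, crossSens]
  simp only [ne_comm]

/-- A reverse Markov inequality for the number of changing coordinates. -/
lemma ofReal_half_le_tsum_crossSens {α : Type*} {K : ℕ} (hK : 1 ≤ K) (ν : PMF α)
    (f : (Fin K → α) → Bool) (x : Fin K → α) {p : ℝ} (hp : 0 < p) (h : p ≤ rowFlipPr ν f x) :
    ENNReal.ofReal (p / 2) ≤ ∑' y : Fin K → α,
      (∏ i, ν (y i)) * (if p * K / 2 ≤ (crossSens f x y : ℝ) then 1 else 0) := by
  set T := ∑' y : Fin K → α,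
      (∏ i, ν (y i)) * (if p * K / 2 ≤ (crossSens f x y : ℝ) then 1 else 0 : ℝ≥0∞) with hT
  have hK0 : (0 : ℝ) < K := by exact_mod_cast hK
  have hsum : p * K ≤ ∑ i, coordFlipPr ν f x i := by
    rw [rowFlipPr, inv_mul_eq_div, le_div_iff₀ hK0] at h
    exact h
  have hpt (y : Fin K → α) : (crossSens f x y : ℝ≥0∞) ≤
      K * (if p * K / 2 ≤ (crossSens f x y : ℝ) then 1 else 0) +
        ENNReal.ofReal (p * K / 2) := by
    split_ifs with hc
    · have : crossSens f x y ≤ K := (Finset.card_le_univ _).trans_eq (Fintype.card_fin K)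
      calc (crossSens f x y : ℝ≥0∞) ≤ K := by exact_mod_cast this
        _ ≤ _ := by simp
    · rw [mul_zero, zero_add, ← ENNReal.ofReal_natCast]
      exact ENNReal.ofReal_le_ofReal (not_le.mp hc).le
  have hmain : ENNReal.ofReal (p * K) ≤ K * T + ENNReal.ofReal (p * K / 2) :=
    calc ENNReal.ofReal (p * K) ≤ ENNReal.ofReal (∑ i, coordFlipPr ν f x i) :=
          ENNReal.ofReal_le_ofReal hsum
      _ = ∑' y : Fin K → α, (∏ i, ν (y i)) * (crossSens f x y : ℝ≥0∞) :=
          ofReal_sum_coordFlipPr ν f x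
      _ ≤ ∑' y : Fin K → α, (∏ i, ν (y i)) *
            (K * (if p * K / 2 ≤ (crossSens f x y : ℝ) then 1 else 0) +
              ENNReal.ofReal (p * K / 2)) :=
          ENNReal.tsum_le_tsum fun y => mul_le_mul_right (hpt y) _
      _ = K * T + ENNReal.ofReal (p * K / 2) := by
          simp only [mul_add, ENNReal.tsum_add, ENNReal.tsum_mul_right, ν.tsum_prod_pi, one_mul,
            mul_left_comm _ (K : ℝ≥0∞), ENNReal.tsum_mul_left, hT]
  have hsplit : ENNReal.ofReal (p * K) =
      K * ENNReal.ofReal (p / 2) + ENNReal.ofReal (p * K / 2) := by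
    rw [← ENNReal.ofReal_natCast, ← ENNReal.ofReal_mul hK0.le,
      ← ENNReal.ofReal_add (by positivity) (by positivity)]
    congr 1
    ring
  rw [hsplit] at hmain
  have hle := (ENNReal.add_le_add_iff_right ENNReal.ofReal_ne_top).mp hmain
  exact (ENNReal.mul_le_mul_iff_right (by exact_mod_cast hK0.ne') (by simp)).mp hle

lemma rowFlipPr_le_add {α : Type*} {K : ℕ} (hK : 1 ≤ K) (μ ν : PMF α)
    (f : (Fin K → α) → Bool) (x : Fin K → α) {δ : ℝ}
    (h : ∀ i, |coordFlipPr μ f x i - coordFlipPr ν f x i| ≤ δ) :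
    rowFlipPr μ f x ≤ rowFlipPr ν f x + δ := by
  have hK0 : (0 : ℝ) < K := by exact_mod_cast hK
  have hs : ∑ i, coordFlipPr μ f x i ≤ ∑ i, coordFlipPr ν f x i + K * δ := by
    calc ∑ i, coordFlipPr μ f x i ≤ ∑ i, (coordFlipPr ν f x i + δ) :=
          Finset.sum_le_sum fun i _ => by linarith [(abs_le.mp (h i)).2]
      _ = _ := by simp [Finset.sum_add_distrib]
  calc rowFlipPr μ f x ≤ (K : ℝ)⁻¹ * (∑ i, coordFlipPr ν f x i + K * δ) :=
        mul_le_mul_of_nonneg_left hs (by positivity)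
    _ = rowFlipPr ν f x + δ := by
        rw [rowFlipPr]
        field_simp

/-- Combining the planting step with the distributional block-insensitivity bound: under the
coordinatewise `μ`-vs-`ν` indistinguishability hypothesis (i) and the sensitivity tail bound
(ii) for the derived functions `g_w`, the probability over `x ~ ν^K` that resampling a uniform
coordinate from `μ` changes `f` with probability at least `p + δ` is at most
`(4K/p)·2^{-pK/(2c)}`. -/
theorem plant_block_insensitivity {α : Type*} {K : ℕ} (hK : 1 ≤ K)
    (f : (Fin K → α) → Bool) (μ ν : PMF α) (δ : ℝ) (hδ : 0 ≤ δ) (c : ℝ) (hc : 0 < c)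
    (hind : ∀ (x : Fin K → α) (i : Fin K),
      |coordFlipPr μ f x i - coordFlipPr ν f x i| ≤ δ)
    (hsens : ∀ w : Bool → Fin K → α, ∀ t : ℝ, 0 < t →
      (∑ z : Fin K → Bool,
          ((2 : ℝ≥0∞) ^ K)⁻¹ * (if t ≤ (sens (gTab f w) z : ℝ) then 1 else 0)) ≤
        ENNReal.ofReal (2 * K * (2 : ℝ) ^ (-(t / c)))) :
    ∀ p : ℝ, 0 < p →
      (∑' x : Fin K → α,
          (∏ i, ν (x i)) * (if p + δ ≤ rowFlipPr μ f x then 1 else 0)) ≤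
        ENNReal.ofReal ((4 * K / p) * (2 : ℝ) ^ (-(p * K / (2 * c)))) := by
  intro p hp
  have hK0 : (0 : ℝ) < K := by exact_mod_cast hK
  have hp2 : 0 < p / 2 := half_pos hp
  have hA := tsum_crossSens_le f ν (p * K / 2) _ fun w => hsens w (p * K / 2) (by positivity)
  have hB : ENNReal.ofReal ((4 * K / p) * (2 : ℝ) ^ (-(p * K / (2 * c)))) =
      ENNReal.ofReal (2 * K * (2 : ℝ) ^ (-(p * K / 2 / c))) / ENNReal.ofReal (p / 2) := by
    rw [← ENNReal.ofReal_div_of_pos hp2, div_div (p * K) 2 c]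
    congr 1
    field_simp
    ring
  rw [hB, ENNReal.le_div_iff_mul_le (Or.inl (by simpa using hp2)) (Or.inl ENNReal.ofReal_ne_top),
    ← ENNReal.tsum_mul_right]
  refine le_trans (ENNReal.tsum_le_tsum fun x => ?_) hA
  rw [mul_assoc]
  refine mul_le_mul_right ?_ _
  split_ifs with hx
  · rw [one_mul]
    refine ofReal_half_le_tsum_crossSens hK ν f x hp ?_
    linarith [rowFlipPr_le_add hK μ ν f x (hind x)]
  · simp
end
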